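/- arXiv:1201.1384 — 2 statements merged into one kernel-verified Lean document; each statement's English description precedes it below -/
import Mathlib

section
/- Let X be a nonempty finite type and p a strictly positive probability mass function on X. With the free energy F(β) = −(1/β)·log Z(β) for β > 0, where Z(β) = Σ_x p(x)^β, the Shannon entropy of the canonical distribution satisfies H(β) = β²·F'(β) for every β > 0, where H(β) = −Σ_x P_β(x)·log P_β(x) and P_β(x) = p(x)^β / Z(β). -/
open Real Finset

/-- With the free energy `F(β) = -(1/β)·log Z(β)`, the Shannon
entropy of the canonical distribution satisfies `H(β) = β²·F'(β)` for every
`β > 0`, where `H(β) = -Σ_x P_β(x)·log P_β(x)` and `P_β(x) = p(x)^β / Z(β)`. -/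
theorem stmt_9 {X : Type*} [Fintype X] [Nonempty X]
    (p : X → ℝ) (hp : ∀ x, 0 < p x) (hp1 : ∑ x, p x = 1)
    (F : ℝ → ℝ)
    (hF : F = fun β => -(1 / β) * Real.log (∑ x, p x ^ β))
    (β : ℝ) (hβ : 0 < β) :
    -∑ x, (p x ^ β / ∑ x', p x' ^ β) * Real.log (p x ^ β / ∑ x', p x' ^ β)
      = β ^ 2 * deriv F β := by
  have hZ : 0 < ∑ x, p x ^ β :=
    Finset.sum_pos (fun x _ => Real.rpow_pos_of_pos (hp x) β) Finset.univ_nonempty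
  have hdZ : HasDerivAt (fun b : ℝ => ∑ x, p x ^ b) (∑ x, p x ^ β * Real.log (p x)) β := by
    apply HasDerivAt.fun_sum
    intro x _
    exact (Real.hasStrictDerivAt_const_rpow (hp x) β).hasDerivAt
  have hdL := hdZ.log hZ.ne'
  have hdI : HasDerivAt (fun b : ℝ => -(1 / b)) (1 / β ^ 2) β := by
    have h := (hasDerivAt_inv hβ.ne').fun_neg
    simpa only [one_div, neg_neg] using h
  have hdF := hdI.fun_mul hdL
  rw [hF, hdF.deriv]
  have hterm : ∀ x, (p x ^ β / ∑ x', p x' ^ β) * Real.log (p x ^ β / ∑ x', p x' ^ β)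
      = (β / ∑ x', p x' ^ β) * (p x ^ β * Real.log (p x))
        - (Real.log (∑ x', p x' ^ β) / ∑ x', p x' ^ β) * p x ^ β := by
    intro x
    rw [Real.log_div (Real.rpow_pos_of_pos (hp x) β).ne' hZ.ne', Real.log_rpow (hp x)]
    ring
  rw [Finset.sum_congr rfl (fun x _ => hterm x), Finset.sum_sub_distrib, ← Finset.mul_sum,
    ← Finset.mul_sum]
  generalize (∑ x, p x ^ β * Real.log (p x)) = D at *
  generalize (∑ x, p x ^ β) = Z at *
  have hZ' := hZ.ne'
  have hβ' := hβ.ne'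
  field_simp
  ring
end

section
/- Let X be a nonempty finite type and p a strictly positive probability mass function on X. Regarding the information energy U(β) = −Σ_x P_β(x)·log p(x) of the canonical distribution P_β(x) = p(x)^β / Z(β) as a function of β > 0, U is antitone (nonincreasing) on (0, ∞): for all 0 < β₁ ≤ β₂, U(β₂) ≤ U(β₁). In particular, along the canonical family, raising the inverse temperature β lowers the information energy, consistent with the interpolation between the maximum entropy and maximum likelihood estimators. -/
open Real Finset

/-- The information energy `U(β) = -Σ_x P_β(x)·log p(x)` of the
canonical distribution `P_β(x) = p(x)^β / Z(β)` is antitone (nonincreasing)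
on `(0, ∞)`: for all `0 < β₁ ≤ β₂`, `U(β₂) ≤ U(β₁)`. -/
theorem stmt_15 {X : Type*} [Fintype X] [Nonempty X]
    (p : X → ℝ) (hp : ∀ x, 0 < p x) (hp1 : ∑ x, p x = 1)
    (U : ℝ → ℝ)
    (hU : U = fun β => -∑ x, (p x ^ β / ∑ x', p x' ^ β) * Real.log (p x)) :
    AntitoneOn U (Set.Ioi 0) := by
  subst hU
  intro β₁ _ β₂ _ hle
  have hZ : ∀ β : ℝ, 0 < ∑ x, p x ^ β := fun β =>
    Finset.sum_pos (fun x _ => Real.rpow_pos_of_pos (hp x) β) Finset.univ_nonempty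
  have key : ∀ x y, 0 ≤ (p x ^ β₂ * p y ^ β₁ - p x ^ β₁ * p y ^ β₂)
      * (Real.log (p x) - Real.log (p y)) := by
    intro x y
    have e : ∀ z, p z ^ β₂ = p z ^ β₁ * p z ^ (β₂ - β₁) := fun z => by
      rw [← Real.rpow_add (hp z)]; congr 1; ring
    have h0 : 0 ≤ (p x ^ (β₂ - β₁) - p y ^ (β₂ - β₁))
        * (Real.log (p x) - Real.log (p y)) := by
      rcases le_total (p x) (p y) with h | h
      · exact mul_nonneg_of_nonpos_of_nonpos
          (sub_nonpos.2 (Real.rpow_le_rpow (hp x).le h (sub_nonneg.2 hle)))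
          (sub_nonpos.2 (Real.log_le_log (hp x) h))
      · exact mul_nonneg
          (sub_nonneg.2 (Real.rpow_le_rpow (hp y).le h (sub_nonneg.2 hle)))
          (sub_nonneg.2 (Real.log_le_log (hp y) h))
    have h1 := mul_nonneg (mul_pos (Real.rpow_pos_of_pos (hp x) β₁)
      (Real.rpow_pos_of_pos (hp y) β₁)).le h0
    rw [e x, e y]
    linarith
  have hsum : 0 ≤ ∑ x, ∑ y, (p x ^ β₂ * p y ^ β₁ - p x ^ β₁ * p y ^ β₂)
      * (Real.log (p x) - Real.log (p y)) :=
    Finset.sum_nonneg fun x _ => Finset.sum_nonneg fun y _ => key x y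
  have hsplit : ∑ x, ∑ y, (p x ^ β₂ * p y ^ β₁ - p x ^ β₁ * p y ^ β₂)
      * (Real.log (p x) - Real.log (p y))
      = 2 * ((∑ x, p x ^ β₂ * Real.log (p x)) * (∑ y, p y ^ β₁)
        - (∑ x, p x ^ β₁ * Real.log (p x)) * (∑ y, p y ^ β₂)) := by
    have t : ∀ x y, (p x ^ β₂ * p y ^ β₁ - p x ^ β₁ * p y ^ β₂)
        * (Real.log (p x) - Real.log (p y))
        = (p x ^ β₂ * Real.log (p x)) * p y ^ β₁ - (p x ^ β₁ * Real.log (p x)) * p y ^ β₂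
        - p x ^ β₂ * (p y ^ β₁ * Real.log (p y))
        + p x ^ β₁ * (p y ^ β₂ * Real.log (p y)) := fun x y => by ring
    simp only [t, Finset.sum_add_distrib, Finset.sum_sub_distrib, ← Finset.sum_mul_sum]
    ring
  have hU' : ∀ β : ℝ, ∑ x, (p x ^ β / ∑ y, p y ^ β) * Real.log (p x)
      = (∑ x, p x ^ β * Real.log (p x)) / ∑ y, p y ^ β := fun β => by
    rw [Finset.sum_div]
    exact Finset.sum_congr rfl fun x _ => by ring
  show -_ ≤ -_
  rw [hU', hU', neg_le_neg_iff, div_le_div_iff₀ (hZ β₁) (hZ β₂)]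
  linarith
end
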